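/- Optimality of the Hardy constant: for n ≥ 3 and any constant C > (n-2)²/4, there exists a Lipschitz function ξ compactly supported in B₁ \ {0} such that ∫_{B₁} |∇ξ|² dx < C ∫_{B₁} ξ²/|x|² dx. -/

import Mathlib

open MeasureTheory Real Metric

/-- Polar coordinates combined with the substitution `r = exp t`. -/
theorem hardy_polar (n : ℕ) (hn : 3 ≤ n) (h : ℝ → ℝ) :
    ∫ x : EuclideanSpace ℝ (Fin n), h (log ‖x‖) / ‖x‖ ^ 2
      = (n * (volume : Measure (EuclideanSpace ℝ (Fin n))).real (ball 0 1))
        * ∫ t : ℝ, exp (((n : ℝ) - 2) * t) * h t := by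
  have : Nonempty (Fin n) := ⟨⟨0, by omega⟩⟩
  have h1 := integral_fun_norm_addHaar (volume : Measure (EuclideanSpace ℝ (Fin n)))
    (fun r : ℝ => h (log r) / r ^ 2)
  rw [h1]
  have h2 := integral_image_eq_integral_abs_deriv_smul (s := Set.univ) (f := Real.exp)
    (f' := Real.exp) MeasurableSet.univ
    (fun x _ => (Real.hasDerivAt_exp x).hasDerivWithinAt) (Real.exp_injective.injOn)
    (fun r : ℝ => r ^ (n - 1) • (h (log r) / r ^ 2))
  rw [Set.image_univ, Real.range_exp, setIntegral_univ] at h2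
  simp only [finrank_euclideanSpace_fin, nsmul_eq_mul, smul_eq_mul] at h2 ⊢
  rw [h2, ← mul_assoc]
  congr 1
  refine integral_congr_ae (Filter.Eventually.of_forall fun t => ?_)
  simp only [abs_of_pos (exp_pos t), log_exp]
  obtain ⟨m, rfl⟩ : ∃ m, n = m + 2 := ⟨n - 2, by omega⟩
  have : exp (((m + 2 : ℕ) - 2 : ℝ) * t) = exp t ^ m := by
    rw [← Real.exp_nat_mul]; push_cast; ring_nf
  rw [this]
  have := (exp_pos t).ne'
  simp only [show m + 2 - 1 = m + 1 from rfl]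
  field_simp
  ring

theorem hardy_of_profile (n : ℕ) (hn : 3 ≤ n) (C : ℝ) (g : ℝ → ℝ) (hg : ContDiff ℝ 1 g)
    (a b : ℝ) (hb : b < 0) (hs : ∀ t, g t ≠ 0 → a ≤ t ∧ t ≤ b)
    (hI : ∫ t : ℝ, exp (((n : ℝ) - 2) * t) * (deriv g t) ^ 2
      < C * ∫ t : ℝ, exp (((n : ℝ) - 2) * t) * (g t) ^ 2) :
    ∃ ξ : EuclideanSpace ℝ (Fin n) → ℝ, ∃ K : NNReal, LipschitzWith K ξ ∧
      HasCompactSupport ξ ∧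
      tsupport ξ ⊆ ball (0 : EuclideanSpace ℝ (Fin n)) 1 \ {0} ∧
      ∫ x in ball (0 : EuclideanSpace ℝ (Fin n)) 1, ‖gradient ξ x‖ ^ 2
        < C * ∫ x in ball (0 : EuclideanSpace ℝ (Fin n)) 1, ξ x ^ 2 / ‖x‖ ^ 2 := by
  have : Nonempty (Fin n) := ⟨⟨0, by omega⟩⟩
  set ξ : EuclideanSpace ℝ (Fin n) → ℝ := fun x => g (log ‖x‖) with hξ
  have hts : tsupport ξ ⊆ {x | exp a ≤ ‖x‖ ∧ ‖x‖ ≤ exp b} := by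
    apply closure_minimal
    · intro x hx
      have h := hs _ hx
      have hx0 : 0 < ‖x‖ := by
        rcases (norm_nonneg x).eq_or_lt with h0 | h0
        · rw [← h0, log_zero] at h; linarith [h.2]
        · exact h0
      exact ⟨(le_log_iff_exp_le hx0).1 h.1, (log_le_iff_le_exp hx0).1 h.2⟩
    · exact (isClosed_le continuous_const continuous_norm).inter
        (isClosed_le continuous_norm continuous_const)
  have hsub : tsupport ξ ⊆ ball (0 : EuclideanSpace ℝ (Fin n)) 1 \ {0} := by
    intro x hx
    obtain ⟨h1, h2⟩ := hts hx
    refine ⟨?_, ?_⟩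
    · rw [mem_ball_zero_iff]
      exact h2.trans_lt (Real.exp_lt_one_iff.2 hb)
    · rintro rfl
      rw [norm_zero] at h1
      linarith [exp_pos a]
  have hcs : HasCompactSupport ξ := by
    refine HasCompactSupport.of_support_subset_isCompact
      (isCompact_closedBall (0 : EuclideanSpace ℝ (Fin n)) 1) ?_
    exact (subset_tsupport ξ).trans (hsub.trans (Set.sdiff_subset.trans ball_subset_closedBall))
  have hsm : ContDiff ℝ 1 ξ := by
    rw [contDiff_iff_contDiffAt]
    intro x
    by_cases hx : x ∈ tsupport ξ
    swap
    · exact contDiffAt_const.congr_of_eventuallyEq (notMem_tsupport_iff_eventuallyEq.1 hx)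
    have hx0 : x ≠ 0 := (hsub hx).2
    exact hg.contDiffAt.comp x ((contDiffAt_norm ℝ hx0).log (norm_ne_zero_iff.2 hx0))
  obtain ⟨K, hK⟩ := hsm.lipschitzWith_of_hasCompactSupport hcs one_ne_zero
  have hgrad : ∀ x, x ≠ 0 → ‖gradient ξ x‖ ^ 2 = (deriv g (log ‖x‖)) ^ 2 / ‖x‖ ^ 2 := by
    intro x hx
    have hx' : ‖x‖ ≠ 0 := norm_ne_zero_iff.2 hx
    have e : ξ = fun y => g (log (‖y‖ ^ 2) / 2) := by
      funext y; simp only [hξ]; congr 1; rw [Real.log_pow]; push_cast; ring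
    have d1 : HasFDerivAt (fun y : EuclideanSpace ℝ (Fin n) => ‖y‖ ^ 2) (2 • innerSL ℝ x) x :=
      (hasStrictFDerivAt_norm_sq x).hasFDerivAt
    have d2 := (d1.log (pow_ne_zero 2 hx')).mul_const (2⁻¹ : ℝ)
    have d3 : HasDerivAt g (deriv g (log ‖x‖)) (log (‖x‖ ^ 2) * 2⁻¹) := by
      have : log (‖x‖ ^ 2) * 2⁻¹ = log ‖x‖ := by rw [Real.log_pow]; push_cast; ring
      rw [this]
      exact (hg.differentiable one_ne_zero _).hasDerivAt
    have d4 := d3.comp_hasFDerivAt x d2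
    have d5 : HasGradientAt ξ ((deriv g (log ‖x‖) / ‖x‖ ^ 2) • x) x := by
      rw [hasGradientAt_iff_hasFDerivAt]
      have : ξ = g ∘ fun y => log (‖y‖ ^ 2) * 2⁻¹ := by
        rw [e]; rfl
      rw [this]
      have hl : (InnerProductSpace.toDual ℝ (EuclideanSpace ℝ (Fin n)))
          ((deriv g (log ‖x‖) / ‖x‖ ^ 2) • x)
          = deriv g (log ‖x‖) • (2⁻¹ : ℝ) • (‖x‖ ^ 2)⁻¹ • 2 • (innerSL ℝ) x := by
        apply ContinuousLinearMap.ext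
        intro v
        simp
        field_simp
      rw [hl]
      exact d4
    rw [d5.gradient, norm_smul, mul_pow, norm_div, norm_pow, norm_norm, Real.norm_eq_abs]
    field_simp
    rw [sq_abs]
  have hz1 : ∀ x, x ∉ ball (0 : EuclideanSpace ℝ (Fin n)) 1 → ‖gradient ξ x‖ ^ 2 = 0 := by
    intro x hx
    have : x ∉ tsupport ξ := fun h => hx (hsub h).1
    have h2 : fderiv ℝ ξ x = 0 := by
      by_contra h
      exact this (support_fderiv_subset ℝ h)
    simp [gradient, h2]
  have hz2 : ∀ x, x ∉ ball (0 : EuclideanSpace ℝ (Fin n)) 1 → ξ x ^ 2 / ‖x‖ ^ 2 = 0 := by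
    intro x hx
    have : x ∉ tsupport ξ := fun h => hx (hsub h).1
    simp [image_eq_zero_of_notMem_tsupport this]
  refine ⟨ξ, K, hK, hcs, hsub, ?_⟩
  rw [setIntegral_eq_integral_of_forall_compl_eq_zero hz1,
    setIntegral_eq_integral_of_forall_compl_eq_zero hz2]
  have i1 : ∫ x, ‖gradient ξ x‖ ^ 2
      = ∫ x : EuclideanSpace ℝ (Fin n), (deriv g (log ‖x‖)) ^ 2 / ‖x‖ ^ 2 := by
    apply integral_congr_ae
    have : ∀ᵐ x : EuclideanSpace ℝ (Fin n), x ≠ 0 := Measure.ae_ne volume 0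
    filter_upwards [this] with x hx using hgrad x hx
  rw [i1, hardy_polar n hn (fun t => (deriv g t) ^ 2), hardy_polar n hn (fun t => (g t) ^ 2),
    mul_left_comm]
  apply mul_lt_mul_of_pos_left hI
  have : 0 < (volume : Measure (EuclideanSpace ℝ (Fin n))).real (ball 0 1) :=
    ENNReal.toReal_pos (measure_ball_pos volume _ one_pos).ne' measure_ball_lt_top.ne
  have : (0 : ℝ) < n := by exact_mod_cast (by omega : 0 < n)
  positivity

theorem hardy_bump : ∃ f : ℝ → ℝ, ContDiff ℝ 1 f ∧ HasCompactSupport f ∧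
    (∀ t, f t ≠ 0 → -3 ≤ t ∧ t ≤ -1) ∧ f (-2) = 1 := by
  let B : ContDiffBump (-2 : ℝ) := ⟨1 / 2, 1, by norm_num, by norm_num⟩
  refine ⟨B, B.contDiff, B.hasCompactSupport, ?_, B.one_of_mem_closedBall (by simp [B])⟩
  intro t ht
  have : t ∈ Function.support B := ht
  rw [B.support_eq, Real.ball_eq_Ioo] at this
  have h1 : B.rOut = 1 := rfl
  rw [h1] at this
  constructor <;> linarith [this.1, this.2]

theorem stmt_18 (n : ℕ) (hn : 3 ≤ n) (C : ℝ) (hC : ((n : ℝ) - 2) ^ 2 / 4 < C) :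
    ∃ ξ : EuclideanSpace ℝ (Fin n) → ℝ, ∃ K : NNReal, LipschitzWith K ξ ∧
      HasCompactSupport ξ ∧
      tsupport ξ ⊆ ball (0 : EuclideanSpace ℝ (Fin n)) 1 \ {0} ∧
      ∫ x in ball (0 : EuclideanSpace ℝ (Fin n)) 1, ‖gradient ξ x‖ ^ 2
        < C * ∫ x in ball (0 : EuclideanSpace ℝ (Fin n)) 1, ξ x ^ 2 / ‖x‖ ^ 2 := by
  obtain ⟨f, hfc, hfs, hsupp, hf2⟩ := hardy_bump
  have hf' : Continuous (deriv f) := hfc.continuous_deriv le_rfl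
  have hfd : ∀ t, HasDerivAt f (deriv f t) t := fun t =>
    (hfc.differentiable one_ne_zero t).hasDerivAt
  have hfs' : HasCompactSupport (deriv f) := hfs.deriv
  have cs1 : HasCompactSupport (fun t => f t ^ 2) :=
    hfs.comp_left (g := fun y : ℝ => y ^ 2) (by simp)
  have cs2 : HasCompactSupport (fun t => deriv f t ^ 2) :=
    hfs'.comp_left (g := fun y : ℝ => y ^ 2) (by simp)
  have j1 : Integrable (fun t => f t ^ 2) := by
    have q : Continuous (fun t => f t ^ 2) := hfc.continuous.pow 2
    exact q.integrable_of_hasCompactSupport cs1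
  have j2 : Integrable (fun t => deriv f t ^ 2) := by
    have q : Continuous (fun t => deriv f t ^ 2) := hf'.pow 2
    exact q.integrable_of_hasCompactSupport cs2
  have j3 : Integrable (fun t => 2 * f t * deriv f t) := by
    have q : Continuous (fun t => 2 * f t * deriv f t) :=
      (continuous_const.mul hfc.continuous).mul hf'
    have r : HasCompactSupport (fun t => 2 * f t * deriv f t) := hfs'.mul_left
    exact q.integrable_of_hasCompactSupport r
  have j4 : ∫ t, 2 * f t * deriv f t = 0 := by
    apply integral_eq_zero_of_hasDerivAt_of_integrable _ j3 j1
    intro t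
    have e := (hfd t).fun_pow 2
    have e' : (2 : ℕ) * f t ^ (2 - 1) * deriv f t = 2 * f t * deriv f t := by norm_num
    rw [e'] at e
    exact e
  have hI0 : 0 < ∫ t, f t ^ 2 := by
    have q : Continuous (fun t => f t ^ 2) := hfc.continuous.pow 2
    exact q.integral_pos_of_hasCompactSupport_nonneg_nonzero (x := -2) cs1
      (fun t => sq_nonneg _) (by simp [hf2])
  set I := ∫ t, f t ^ 2 with hI
  set J := ∫ t, deriv f t ^ 2 with hJ
  set β : ℝ := ((n : ℝ) - 2) / 2 with hβ
  have hCβ : 0 < C - β ^ 2 := by rw [hβ]; linarith [hC, show (((n : ℝ) - 2) / 2) ^ 2 = ((n : ℝ) - 2) ^ 2 / 4 by ring]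
  -- a small scale
  obtain ⟨c, hc0, hc⟩ : ∃ c : ℝ, 0 < c ∧ c ^ 2 * J < (C - β ^ 2) * I := by
    have hT : Filter.Tendsto (fun c : ℝ => c ^ 2 * J) (nhdsWithin 0 (Set.Ioi 0)) (nhds 0) := by
      have : Continuous (fun c : ℝ => c ^ 2 * J) := by fun_prop
      simpa using (this.tendsto 0).mono_left nhdsWithin_le_nhds
    have h2 := (hT.eventually_lt_const (mul_pos hCβ hI0)).and self_mem_nhdsWithin
    obtain ⟨c, h3, h4⟩ := h2.exists
    exact ⟨c, h4, h3⟩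
  have hgd : ∀ t, HasDerivAt (fun t => exp (-β * t) * f (c * t))
      (exp (-β * t) * (c * deriv f (c * t) - β * f (c * t))) t := by
    intro t
    have e1 : HasDerivAt (fun t : ℝ => exp (-β * t)) (exp (-β * t) * (-β * 1)) t :=
      ((hasDerivAt_id t).const_mul (-β)).exp
    have e2 : HasDerivAt (fun t : ℝ => f (c * t)) (deriv f (c * t) * (c * 1)) t :=
      (hfd (c * t)).comp t ((hasDerivAt_id t).const_mul c)
    have e3 := e1.fun_mul e2
    have e4 : exp (-β * t) * (c * deriv f (c * t) - β * f (c * t))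
        = exp (-β * t) * (-β * 1) * f (c * t) + exp (-β * t) * (deriv f (c * t) * (c * 1)) := by
      ring
    rw [e4]
    exact e3
  have hexp : ∀ t, exp (((n : ℝ) - 2) * t) * exp (-β * t) ^ 2 = 1 := by
    intro t
    rw [← Real.exp_nat_mul, ← Real.exp_add, hβ, ← Real.exp_zero]
    congr 1; push_cast; ring
  refine hardy_of_profile n hn C (fun t => exp (-β * t) * f (c * t)) ?_ (-3 / c) (-1 / c) ?_ ?_ ?_
  · exact (contDiff_const.mul contDiff_id).exp.mul (hfc.comp (contDiff_const.mul contDiff_id))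
  · exact div_neg_of_neg_of_pos (by norm_num) hc0
  · intro t ht
    have := hsupp (c * t) (right_ne_zero_of_mul ht)
    constructor
    · rw [div_le_iff₀ hc0]; linarith [this.1]
    · rw [le_div_iff₀ hc0]; linarith [this.2]
  · have k1 : ∀ t, exp (((n : ℝ) - 2) * t) * (deriv (fun t => exp (-β * t) * f (c * t)) t) ^ 2
        = (fun s => c ^ 2 * deriv f s ^ 2 - (c * β) * (2 * f s * deriv f s) + β ^ 2 * f s ^ 2)
          (c * t) := by
      intro t
      rw [(hgd t).deriv, mul_pow, ← mul_assoc, hexp]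
      ring
    have k2 : ∀ t, exp (((n : ℝ) - 2) * t) * (exp (-β * t) * f (c * t)) ^ 2
        = (fun s => f s ^ 2) (c * t) := by
      intro t
      rw [mul_pow, ← mul_assoc, hexp, one_mul]
    rw [integral_congr_ae (Filter.Eventually.of_forall k1),
      integral_congr_ae (Filter.Eventually.of_forall k2)]
    rw [Measure.integral_comp_mul_left (fun s => c ^ 2 * deriv f s ^ 2
      - (c * β) * (2 * f s * deriv f s) + β ^ 2 * f s ^ 2), Measure.integral_comp_mul_left (fun s => f s ^ 2)]
    have j5 : Integrable (fun t => c ^ 2 * deriv f t ^ 2 - c * β * (2 * f t * deriv f t)) :=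
      (j2.const_mul _).sub (j3.const_mul _)
    rw [integral_add j5 (j1.const_mul _),
      integral_sub (j2.const_mul _) (j3.const_mul _), integral_const_mul, integral_const_mul,
      integral_const_mul, j4, ← hI, ← hJ, smul_eq_mul, smul_eq_mul, mul_left_comm]
    apply mul_lt_mul_of_pos_left _ (abs_pos.2 (inv_ne_zero hc0.ne'))
    linarith
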